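/- arXiv:2110.15583 — 2 statements merged into one kernel-verified Lean document; each statement's English description precedes it below -/
import Mathlib

section
/- Let e₁ = E₁₄, e₂ = E₂₄, e₄ = E₃₂ − E₂₃, e₅ = E₁₃ − E₃₁ be 4 × 4 real matrices (E_{ij} has 1 in entry (i,j) and 0 elsewhere). Then the real span of {e₁, e₂, e₄, e₅} is closed under double brackets: for all A, B, C in span_ℝ{e₁, e₂, e₄, e₅}, the matrix ⁅⁅A,B⁆,C⁆ again lies in span_ℝ{e₁, e₂, e₄, e₅}. Hence span_ℝ{e₁, e₂, e₄, e₅} is a Lie triple system in se(3). -/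
open Matrix

/-- A commutator of two elements of `span {e₁, e₂, e₄, e₅}` lies in `span {e₃, e₆}`. -/
lemma se3_lie_e1_e2_e4_e5 (a b c d a' b' c' d' : ℝ) :
    ⁅(!![0, 0, d, a; 0, 0, -c, b; -d, c, 0, 0; 0, 0, 0, 0] : Matrix (Fin 4) (Fin 4) ℝ),
      !![0, 0, d', a'; 0, 0, -c', b'; -d', c', 0, 0; 0, 0, 0, 0]⁆ =
      !![0, -(c * d' - c' * d), 0, 0;
        c * d' - c' * d, 0, 0, 0;
        0, 0, 0, c * b' - d * a' - (c' * b - d' * a);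
        0, 0, 0, 0] := by
  rw [Ring.lie_def]
  ext i j
  fin_cases i <;> fin_cases j <;> simp <;> ring

/-- A commutator of an element of `span {e₃, e₆}` with an element of `span {e₁, e₂, e₄, e₅}`
lies in `span {e₁, e₂, e₄, e₅}`. -/
lemma se3_lie_e3_e6_e1_e2_e4_e5 (t w a b c d : ℝ) :
    ⁅(!![0, -w, 0, 0; w, 0, 0, 0; 0, 0, 0, t; 0, 0, 0, 0] : Matrix (Fin 4) (Fin 4) ℝ),
      !![0, 0, d, a; 0, 0, -c, b; -d, c, 0, 0; 0, 0, 0, 0]⁆ =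
      !![0, 0, w * c, -(w * b) - d * t;
        0, 0, -(-(w * d)), w * a + c * t;
        -(w * c), -(w * d), 0, 0;
        0, 0, 0, 0] := by
  rw [Ring.lie_def]
  ext i j
  fin_cases i <;> fin_cases j <;> simp <;> ring

/-- The real span of the `se(3)` basis elements `e₁ = E₁₄`, `e₂ = E₂₄`,
`e₄ = E₃₂ − E₂₃`, `e₅ = E₁₃ − E₃₁` is closed under double Lie brackets,
hence is a Lie triple system in `se(3)` (one of the seven conjugacy classes
of Lie triple subsystems, corresponding to a symmetric submanifold of `SE(3)`). -/
theorem se3_span_e1_e2_e4_e5_lie_triple_system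
    (e₁ e₂ e₄ e₅ : Matrix (Fin 4) (Fin 4) ℝ)
    (h₁ : e₁ = !![0, 0, 0, 1; 0, 0, 0, 0; 0, 0, 0, 0; 0, 0, 0, 0])
    (h₂ : e₂ = !![0, 0, 0, 0; 0, 0, 0, 1; 0, 0, 0, 0; 0, 0, 0, 0])
    (h₄ : e₄ = !![0, 0, 0, 0; 0, 0, -1, 0; 0, 1, 0, 0; 0, 0, 0, 0])
    (h₅ : e₅ = !![0, 0, 1, 0; 0, 0, 0, 0; -1, 0, 0, 0; 0, 0, 0, 0]) :
    ∀ A ∈ Submodule.span ℝ {e₁, e₂, e₄, e₅},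
      ∀ B ∈ Submodule.span ℝ {e₁, e₂, e₄, e₅},
        ∀ C ∈ Submodule.span ℝ {e₁, e₂, e₄, e₅},
          ⁅⁅A, B⁆, C⁆ ∈ Submodule.span ℝ {e₁, e₂, e₄, e₅} := by
  have mem_iff (M : Matrix (Fin 4) (Fin 4) ℝ) : M ∈ Submodule.span ℝ {e₁, e₂, e₄, e₅} ↔
      ∃ a b c d : ℝ, !![0, 0, d, a; 0, 0, -c, b; -d, c, 0, 0; 0, 0, 0, 0] = M := by
    have comb (a b c d : ℝ) : a • e₁ + (b • e₂ + (c • e₄ + d • e₅)) =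
        !![0, 0, d, a; 0, 0, -c, b; -d, c, 0, 0; 0, 0, 0, 0] := by
      subst h₁ h₂ h₄ h₅
      ext i j
      fin_cases i <;> fin_cases j <;> simp
    simp only [Submodule.mem_span_insert, Submodule.mem_span_singleton, ← comb]
    constructor
    · rintro ⟨a, _, ⟨b, _, ⟨c, _, ⟨d, rfl⟩, rfl⟩, rfl⟩, rfl⟩
      exact ⟨a, b, c, d, rfl⟩
    · rintro ⟨a, b, c, d, rfl⟩
      exact ⟨a, _, ⟨b, _, ⟨c, _, ⟨d, rfl⟩, rfl⟩, rfl⟩, rfl⟩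
  simp only [mem_iff]
  rintro _ ⟨a, b, c, d, rfl⟩ _ ⟨a', b', c', d', rfl⟩ _ ⟨x, y, z, u, rfl⟩
  rw [se3_lie_e1_e2_e4_e5, se3_lie_e3_e6_e1_e2_e4_e5]
  exact ⟨_, _, _, _, rfl⟩
end

section
/- Let e₁ = E₁₄, e₂ = E₂₄, e₃ = E₃₄, e₄ = E₃₂ − E₂₃, e₅ = E₁₃ − E₃₁ be 4 × 4 real matrices (E_{ij} has 1 in entry (i,j) and 0 elsewhere). Then the real span of {e₁, e₂, e₃, e₄, e₅} is closed under double brackets: for all A, B, C in span_ℝ{e₁, e₂, e₃, e₄, e₅}, the matrix ⁅⁅A,B⁆,C⁆ again lies in span_ℝ{e₁, e₂, e₃, e₄, e₅}. Hence span_ℝ{e₁, e₂, e₃, e₄, e₅} is a Lie triple system in se(3). -/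
open Matrix

/-- The rigid-motion generator with translational part `(a, b, c)` and angular part `(d, e, 0)`. -/
def planarAxisTwist (a b c d e : ℝ) : Matrix (Fin 4) (Fin 4) ℝ :=
  !![0, 0, e, a; 0, 0, -d, b; -e, d, 0, c; 0, 0, 0, 0]

theorem mem_span_iff_exists_planarAxisTwist (X : Matrix (Fin 4) (Fin 4) ℝ) :
    X ∈ Submodule.span ℝ
      {!![0, 0, 0, 1; 0, 0, 0, 0; 0, 0, 0, 0; 0, 0, 0, 0],
        !![0, 0, 0, 0; 0, 0, 0, 1; 0, 0, 0, 0; 0, 0, 0, 0],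
        !![0, 0, 0, 0; 0, 0, 0, 0; 0, 0, 0, 1; 0, 0, 0, 0],
        !![0, 0, 0, 0; 0, 0, -1, 0; 0, 1, 0, 0; 0, 0, 0, 0],
        !![0, 0, 1, 0; 0, 0, 0, 0; -1, 0, 0, 0; 0, 0, 0, 0]} ↔
      ∃ a b c d e, planarAxisTwist a b c d e = X := by
  simp only [Submodule.mem_span_insert, Submodule.mem_span_singleton]
  constructor
  · rintro ⟨a, _, ⟨b, _, ⟨c, _, ⟨d, _, ⟨e, rfl⟩, rfl⟩, rfl⟩, rfl⟩, rfl⟩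
    refine ⟨a, b, c, d, e, ?_⟩
    ext i j
    fin_cases i <;> fin_cases j <;> simp [planarAxisTwist]
  · rintro ⟨a, b, c, d, e, rfl⟩
    refine ⟨a, _, ⟨b, _, ⟨c, _, ⟨d, _, ⟨e, rfl⟩, rfl⟩, rfl⟩, rfl⟩, ?_⟩
    ext i j
    fin_cases i <;> fin_cases j <;> simp [planarAxisTwist]

theorem lie_lie_planarAxisTwist (a b c d e a' b' c' d' e' a'' b'' c'' d'' e'' : ℝ) :
    ⁅⁅planarAxisTwist a b c d e, planarAxisTwist a' b' c' d' e'⁆,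
        planarAxisTwist a'' b'' c'' d'' e''⁆ =
      planarAxisTwist
        (-(d * e' - e * d') * b'' - e'' * (d * b' - e * a' - d' * b + e' * a))
        ((d * e' - e * d') * a'' + d'' * (d * b' - e * a' - d' * b + e' * a))
        (d'' * (d * c' - d' * c) + e'' * (e * c' - e' * c))
        (-(d * e' - e * d') * e'')
        ((d * e' - e * d') * d'') := by
  ext i j
  fin_cases i <;> fin_cases j <;>
    simp [planarAxisTwist, Ring.lie_def] <;> ring

/-- The real span of the `se(3)` basis elements `e₁ = E₁₄`, `e₂ = E₂₄`,
`e₃ = E₃₄`, `e₄ = E₃₂ − E₂₃`, `e₅ = E₁₃ − E₃₁` is closed under double Lie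
brackets, hence is a Lie triple system in `se(3)` (one of the seven conjugacy
classes of Lie triple subsystems, corresponding to a symmetric submanifold of
`SE(3)`). -/
theorem se3_span_e1_e2_e3_e4_e5_lie_triple_system
    (e₁ e₂ e₃ e₄ e₅ : Matrix (Fin 4) (Fin 4) ℝ)
    (h₁ : e₁ = !![0, 0, 0, 1; 0, 0, 0, 0; 0, 0, 0, 0; 0, 0, 0, 0])
    (h₂ : e₂ = !![0, 0, 0, 0; 0, 0, 0, 1; 0, 0, 0, 0; 0, 0, 0, 0])
    (h₃ : e₃ = !![0, 0, 0, 0; 0, 0, 0, 0; 0, 0, 0, 1; 0, 0, 0, 0])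
    (h₄ : e₄ = !![0, 0, 0, 0; 0, 0, -1, 0; 0, 1, 0, 0; 0, 0, 0, 0])
    (h₅ : e₅ = !![0, 0, 1, 0; 0, 0, 0, 0; -1, 0, 0, 0; 0, 0, 0, 0]) :
    ∀ A ∈ Submodule.span ℝ {e₁, e₂, e₃, e₄, e₅},
      ∀ B ∈ Submodule.span ℝ {e₁, e₂, e₃, e₄, e₅},
        ∀ C ∈ Submodule.span ℝ {e₁, e₂, e₃, e₄, e₅},
          ⁅⁅A, B⁆, C⁆ ∈ Submodule.span ℝ {e₁, e₂, e₃, e₄, e₅} := by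
  subst h₁ h₂ h₃ h₄ h₅
  simp only [mem_span_iff_exists_planarAxisTwist]
  rintro _ ⟨a, b, c, d, e, rfl⟩ _ ⟨a', b', c', d', e', rfl⟩ _ ⟨a'', b'', c'', d'', e'', rfl⟩
  exact ⟨_, _, _, _, _, (lie_lie_planarAxisTwist ..).symm⟩
end
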